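/- Let h : ℝ → ℂ be a smooth function whose support is a compact subset of (0, ∞), and let K be a compact subset of (0, ∞). Then there exist constants C > 0 and α₀ > 0 (depending only on h and K) such that for all real α ≥ α₀ and all real β with β/α ∈ K, one has | ∫₀^∞ h(t) e(α t³ − β t²) dt − (2β)^{−1/2} e( −4β³/(27α²) + 1/8 ) · h( 2β/(3α) ) | ≤ C α^{−3/2}. -/

import Mathlib

open MeasureTheory

/-- `e x = exp(2πix)`. -/
noncomputable def e (x : ℝ) : ℂ := Complex.exp (2 * Real.pi * Complex.I * x)

open FourierTransform SchwartzMap in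
theorem integral_schwartz_mul_gaussian (B : 𝓢(ℝ, ℂ)) {b : ℂ} (hb : 0 < b.re) :
    ∫ u : ℝ, 𝓕 B u * Complex.exp (-Real.pi * b * u ^ 2) =
      ∫ t : ℝ, B t * (1 / b ^ (1 / 2 : ℂ) * Complex.exp (-Real.pi / b * t ^ 2)) := by
  have hg : Integrable (fun u : ℝ ↦ Complex.exp (-Real.pi * b * u ^ 2)) := by
    have := integrable_cexp_neg_mul_sq (b := Real.pi * b)
      (by rw [Complex.re_ofReal_mul]; positivity)
    simpa only [neg_mul] using this
  have key : ∫ ξ : ℝ, 𝓕 (B : ℝ → ℂ) ξ * Complex.exp (-Real.pi * b * ξ ^ 2) =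
      ∫ x : ℝ, B x * 𝓕 (fun u : ℝ ↦ Complex.exp (-Real.pi * b * u ^ 2)) x := by
    simpa using! VectorFourier.integral_bilin_fourierIntegral_eq_flip
      (ContinuousLinearMap.mul ℂ ℂ) (L := innerₗ ℝ)
      Real.continuous_fourierChar continuous_inner B.integrable hg
  rw [fourier_gaussian_pi hb] at key
  simpa only [fourier_coe] using key

theorem norm_cexp_sub_one_le_of_re_nonpos {z : ℂ} (hz : z.re ≤ 0) :
    ‖Complex.exp z - 1‖ ≤ ‖z‖ := by
  have := Convex.norm_image_sub_le_of_norm_deriv_le (𝕜 := ℂ) (f := Complex.exp)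
    (s := {w : ℂ | w.re ≤ 0}) (x := 0) (y := z) (C := 1)
    (fun x _ ↦ Complex.differentiableAt_exp)
    (fun x hx ↦ by simpa [Complex.norm_exp] using hx)
    (convex_halfSpace_re_le 0) (by simp) hz
  simpa using this

theorem neg_two_mul_I_cpow_half {Λ : ℝ} (hΛ : 0 < Λ) :
    1 / (-(2 * Λ) * Complex.I : ℂ) ^ (1 / 2 : ℂ) =
      ((1 / Real.sqrt (2 * Λ) : ℝ) : ℂ) * e (1 / 8) := by
  have h1 : (-(2 * Λ) * Complex.I : ℂ) = ((2 * Λ : ℝ) : ℂ) * (-Complex.I) := by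
    push_cast; ring
  have hne : (-(2 * Λ) * Complex.I : ℂ) ≠ 0 := by
    simp [hΛ.ne']
  have hlog : ((Real.log (2 * Λ) : ℝ) : ℂ) * (1 / 2 : ℂ) = ((Real.log (2 * Λ) / 2 : ℝ) : ℂ) := by
    push_cast; ring
  rw [Complex.cpow_def_of_ne_zero hne, h1, Complex.log_ofReal_mul (by positivity)
    (by simp), Complex.log_neg_I, add_mul, Complex.exp_add, hlog,
    ← Complex.ofReal_exp, ← Real.log_sqrt (by positivity), Real.exp_log (by positivity), e]
  rw [one_div, mul_inv, ← Complex.exp_neg]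
  push_cast
  rw [one_div]
  congr 2 <;> ring

open FourierTransform SchwartzMap in
theorem norm_integral_schwartz_mul_gaussian_sub_le (B : 𝓢(ℝ, ℂ)) {b : ℂ} (hb : 0 < b.re) :
    ‖(∫ u : ℝ, 𝓕 B u * Complex.exp (-Real.pi * b * u ^ 2)) - 1 / b ^ (1 / 2 : ℂ) * 𝓕 B 0‖ ≤
      (Real.pi * ∫ t : ℝ, ‖t‖ ^ 2 * ‖B t‖) * ‖b‖ ^ (-(3 : ℝ) / 2) := by
  have hb0 : b ≠ 0 := by rintro rfl; simp at hb
  have hnb : 0 < ‖b‖ := norm_pos_iff.mpr hb0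
  have h0 : 𝓕 B 0 = ∫ t : ℝ, B t := by
    rw [fourier_coe, Real.fourier_real_eq]
    simp
  have hre : ∀ t : ℝ, (-Real.pi / b * t ^ 2 : ℂ).re ≤ 0 := by
    intro t
    have : (-Real.pi / b * t ^ 2 : ℂ) = ((-(Real.pi * t ^ 2) : ℝ) : ℂ) * b⁻¹ := by
      push_cast; field_simp
    rw [this, Complex.re_ofReal_mul, Complex.inv_re]
    have : 0 ≤ b.re / Complex.normSq b := div_nonneg hb.le (Complex.normSq_nonneg _)
    have : 0 ≤ Real.pi * t ^ 2 := by positivity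
    nlinarith
  have hexp : ∀ t : ℝ, ‖Complex.exp (-Real.pi / b * t ^ 2)‖ ≤ 1 := fun t ↦ by
    rw [Complex.norm_exp]; exact Real.exp_le_one_iff.mpr (hre t)
  have h_integrable : Integrable fun t : ℝ ↦
      B t * (1 / b ^ (1 / 2 : ℂ) * Complex.exp (-Real.pi / b * t ^ 2)) := by
    refine B.integrable.mul_bdd (c := ‖1 / b ^ (1 / 2 : ℂ)‖) ?_ ?_
    · exact Continuous.aestronglyMeasurable (by fun_prop)
    · refine .of_forall fun t ↦ ?_
      rw [norm_mul]
      exact mul_le_of_le_one_right (norm_nonneg _) (hexp t)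
  have hcp : ‖1 / b ^ (1 / 2 : ℂ)‖ = ‖b‖ ^ (-(1 / 2) : ℝ) := by
    rw [norm_div, Complex.norm_cpow_of_ne_zero hb0, Real.rpow_neg hnb.le]
    simp
  rw [integral_schwartz_mul_gaussian B hb, h0, ← integral_const_mul,
    ← integral_sub h_integrable (B.integrable.const_mul _)]
  have hpt : ∀ t : ℝ, ‖B t * (1 / b ^ (1 / 2 : ℂ) * Complex.exp (-Real.pi / b * t ^ 2)) -
      1 / b ^ (1 / 2 : ℂ) * B t‖ ≤
      (Real.pi * ‖b‖ ^ (-(3 : ℝ) / 2)) * (‖t‖ ^ 2 * ‖B t‖) := by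
    intro t
    have h1 : B t * (1 / b ^ (1 / 2 : ℂ) * Complex.exp (-Real.pi / b * t ^ 2)) -
      1 / b ^ (1 / 2 : ℂ) * B t =
      1 / b ^ (1 / 2 : ℂ) * B t * (Complex.exp (-Real.pi / b * t ^ 2) - 1) := by ring
    rw [h1, norm_mul, norm_mul, hcp]
    have h2 := norm_cexp_sub_one_le_of_re_nonpos (hre t)
    have h3 : ‖(-Real.pi / b * t ^ 2 : ℂ)‖ = Real.pi * ‖b‖ ^ (-1 : ℝ) * ‖t‖ ^ 2 := by
      rw [Real.rpow_neg_one, norm_mul, norm_div, norm_neg, norm_pow, Complex.norm_real,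
        Complex.norm_real, Real.norm_of_nonneg Real.pi_pos.le]
      ring
    have h4 : ‖b‖ ^ (-(3 : ℝ) / 2) = ‖b‖ ^ (-(1 / 2) : ℝ) * ‖b‖ ^ (-1 : ℝ) := by
      rw [← Real.rpow_add hnb]; norm_num
    rw [h3] at h2
    calc _ ≤ ‖b‖ ^ (-(1 / 2) : ℝ) * ‖B t‖ * (Real.pi * ‖b‖ ^ (-1 : ℝ) * ‖t‖ ^ 2) := by gcongr
      _ = _ := by rw [h4]; ring
  calc _ ≤ ∫ t : ℝ, (Real.pi * ‖b‖ ^ (-(3 : ℝ) / 2)) * (‖t‖ ^ 2 * ‖B t‖) :=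
        norm_integral_le_of_norm_le ((B.integrable_pow_mul volume 2).const_mul _) (.of_forall hpt)
    _ = _ := by rw [integral_const_mul]; ring

open FourierTransform SchwartzMap Filter Topology in
theorem exists_norm_integral_mul_e_sq_sub_le (b : 𝓢(ℝ, ℂ)) :
    ∃ C, ∀ Λ : ℝ, 0 < Λ → ‖(∫ u : ℝ, b u * e (Λ * u ^ 2)) -
      ((1 / Real.sqrt (2 * Λ) : ℝ) : ℂ) * e (1 / 8) * b 0‖ ≤ C * Λ ^ (-(3 : ℝ) / 2) := by
  obtain ⟨B, rfl⟩ : ∃ B : 𝓢(ℝ, ℂ), 𝓕 B = b := ⟨𝓕⁻ b, FourierTransform.fourier_fourierInv_eq b⟩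
  refine ⟨Real.pi * ∫ t : ℝ, ‖t‖ ^ 2 * ‖B t‖, fun Λ hΛ ↦ ?_⟩
  set D := Real.pi * ∫ t : ℝ, ‖t‖ ^ 2 * ‖B t‖
  have hD : 0 ≤ D := mul_nonneg Real.pi_pos.le (integral_nonneg fun t ↦ by positivity)
  let β : ℝ → ℂ := fun ε ↦ ε + -(2 * Λ) * Complex.I
  have hβ0 : Tendsto β (𝓝[>] 0) (𝓝 (-(2 * Λ) * Complex.I)) := by
    have : Continuous β := by fun_prop
    have h2 := this.tendsto 0
    simp only [β, Complex.ofReal_zero, zero_add] at h2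
    exact h2.mono_left nhdsWithin_le_nhds
  have hslit : (-(2 * Λ) * Complex.I : ℂ) ∈ Complex.slitPlane := by
    right
    simp [hΛ.ne']
  have hcp : Tendsto (fun ε ↦ 1 / (β ε) ^ (1 / 2 : ℂ) * 𝓕 B 0) (𝓝[>] 0)
      (𝓝 (((1 / Real.sqrt (2 * Λ) : ℝ) : ℂ) * e (1 / 8) * 𝓕 B 0)) := by
    rw [← neg_two_mul_I_cpow_half hΛ]
    refine Tendsto.mul_const _ (Tendsto.div tendsto_const_nhds ?_ ?_)
    · exact ((continuousAt_cpow_const hslit).tendsto).comp hβ0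
    · rw [Complex.cpow_def_of_ne_zero (Complex.slitPlane_ne_zero hslit)]
      exact Complex.exp_ne_zero _
  have hI : Tendsto (fun ε ↦ ∫ u : ℝ, 𝓕 B u * Complex.exp (-Real.pi * β ε * u ^ 2)) (𝓝[>] 0)
      (𝓝 (∫ u : ℝ, 𝓕 B u * e (Λ * u ^ 2))) := by
    refine tendsto_integral_filter_of_dominated_convergence (fun u ↦ ‖𝓕 B u‖) ?_ ?_
      (𝓕 B).integrable.norm ?_
    · refine .of_forall fun ε ↦ Continuous.aestronglyMeasurable ?_
      exact (𝓕 B).continuous.mul (by fun_prop)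
    · filter_upwards [self_mem_nhdsWithin] with ε hε
      refine .of_forall fun u ↦ ?_
      rw [norm_mul]
      refine mul_le_of_le_one_right (norm_nonneg _) ?_
      rw [Complex.norm_exp, Real.exp_le_one_iff]
      have : (-Real.pi * β ε * u ^ 2 : ℂ) = ((-(Real.pi * u ^ 2) : ℝ) : ℂ) * β ε := by
        push_cast; ring
      rw [this, Complex.re_ofReal_mul]
      have h1 : (β ε).re = ε := by simp [β]
      have h2 : (0 : ℝ) < ε := hε
      have : 0 ≤ Real.pi * u ^ 2 := by positivity
      rw [h1]
      nlinarith
    · refine .of_forall fun u ↦ Tendsto.const_mul _ ?_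
      have hc : Continuous fun z : ℂ ↦ Complex.exp (-Real.pi * z * u ^ 2) := by fun_prop
      have := (hc.tendsto (-(2 * Λ) * Complex.I)).comp hβ0
      have he : e (Λ * u ^ 2) = Complex.exp (-Real.pi * (-(2 * Λ) * Complex.I) * u ^ 2) := by
        rw [e]
        congr 1
        push_cast
        ring
      rw [he]
      exact this
  refine le_of_tendsto (hI.sub hcp).norm ?_
  filter_upwards [self_mem_nhdsWithin] with ε hε
  have hre : (β ε).re = ε := by simp [β]
  have him : (β ε).im = -(2 * Λ) := by simp [β]
  refine (norm_integral_schwartz_mul_gaussian_sub_le B (b := β ε) (by rw [hre]; exact hε)).trans ?_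
  refine mul_le_mul_of_nonneg_left ?_ hD
  refine Real.rpow_le_rpow_of_nonpos hΛ ?_ (by norm_num)
  have := Complex.abs_im_le_norm (β ε)
  rw [him, abs_neg, abs_of_pos (by positivity)] at this
  linarith

/-- A family of smooth functions on `ℝ` all of whose derivatives are bounded uniformly in the
family and in the variable. -/
structure UniformlySmoothBounded {ι : Type*} (f : ι → ℝ → ℂ) : Prop where
  contDiff : ∀ i, ContDiff ℝ (⊤ : ℕ∞) (f i)
  exists_bound : ∀ n : ℕ, ∃ M, ∀ i x, ‖iteratedDeriv n (f i) x‖ ≤ M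

namespace UniformlySmoothBounded

variable {ι : Type*} {f g : ι → ℝ → ℂ}

theorem bound_apply (hf : UniformlySmoothBounded f) : ∃ M, ∀ i x, ‖f i x‖ ≤ M := by
  simpa using hf.exists_bound 0

theorem deriv (hf : UniformlySmoothBounded f) :
    UniformlySmoothBounded fun i ↦ _root_.deriv (f i) where
  contDiff i := ((contDiff_infty_iff_deriv (𝕜 := ℝ)).mp (hf.contDiff i)).2
  exists_bound n := by
    obtain ⟨M, hM⟩ := hf.exists_bound (n + 1)
    exact ⟨M, fun i x ↦ by simpa [iteratedDeriv_succ'] using hM i x⟩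

theorem sub (hf : UniformlySmoothBounded f) (hg : UniformlySmoothBounded g) :
    UniformlySmoothBounded fun i x ↦ f i x - g i x where
  contDiff i := (hf.contDiff i).sub (hg.contDiff i)
  exists_bound n := by
    obtain ⟨M, hM⟩ := hf.exists_bound n
    obtain ⟨N, hN⟩ := hg.exists_bound n
    refine ⟨M + N, fun i x ↦ ?_⟩
    have : iteratedDeriv n (fun x ↦ f i x - g i x) x =
        iteratedDeriv n (f i) x - iteratedDeriv n (g i) x :=
      iteratedDeriv_fun_sub ((hf.contDiff i).contDiffAt.of_le (by exact_mod_cast le_top))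
        ((hg.contDiff i).contDiffAt.of_le (by exact_mod_cast le_top))
    rw [this]
    exact (norm_sub_le _ _).trans (add_le_add (hM i x) (hN i x))

theorem mul (hf : UniformlySmoothBounded f) (hg : UniformlySmoothBounded g) :
    UniformlySmoothBounded fun i x ↦ f i x * g i x where
  contDiff i := (hf.contDiff i).mul (hg.contDiff i)
  exists_bound n := by
    choose M hM using hf.exists_bound
    choose N hN using hg.exists_bound
    refine ⟨∑ k ∈ Finset.range (n + 1), (n.choose k : ℝ) * M k * N (n - k), fun i x ↦ ?_⟩
    rw [← norm_iteratedFDeriv_eq_norm_iteratedDeriv]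
    refine (norm_iteratedFDeriv_mul_le (hf.contDiff i) (hg.contDiff i) x
      (by exact_mod_cast le_top)).trans (Finset.sum_le_sum fun k _ ↦ ?_)
    rw [norm_iteratedFDeriv_eq_norm_iteratedDeriv, norm_iteratedFDeriv_eq_norm_iteratedDeriv]
    have := (norm_nonneg _).trans (hM k i x)
    gcongr
    exacts [hM k i x, hN _ i x]

theorem of_const {c : ι → ℂ} {M : ℝ} (hc : ∀ i, ‖c i‖ ≤ M) :
    UniformlySmoothBounded fun i (_ : ℝ) ↦ c i where
  contDiff _ := contDiff_const
  exists_bound n := by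
    refine ⟨M, fun i x ↦ ?_⟩
    rw [iteratedDeriv_const]
    split_ifs
    · exact hc i
    · simpa using (norm_nonneg _).trans (hc i)

theorem of_hasCompactSupport {h : ℝ → ℂ} (hs : ContDiff ℝ (⊤ : ℕ∞) h)
    (hc : HasCompactSupport h) : UniformlySmoothBounded fun _ : ι ↦ h where
  contDiff _ := hs
  exists_bound n := by
    obtain ⟨M, hM⟩ := (hs.continuous_iteratedFDeriv (m := n)
      (by exact_mod_cast le_top)).bounded_above_of_compact_support (hc.iteratedFDeriv n)
    exact ⟨M, fun _ x ↦ by simpa [norm_iteratedFDeriv_eq_norm_iteratedDeriv] using hM x⟩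

theorem comp_mul {h : ℝ → ℂ} (hh : UniformlySmoothBounded fun _ : Unit ↦ h) {c : ι → ℝ} {R : ℝ}
    (hc : ∀ i, |c i| ≤ R) : UniformlySmoothBounded fun i x ↦ h (c i * x) where
  contDiff i := (hh.contDiff ()).comp (by fun_prop)
  exists_bound n := by
    obtain ⟨M, hM⟩ := hh.exists_bound n
    refine ⟨R ^ n * M, fun i x ↦ ?_⟩
    have : iteratedDeriv n (fun x ↦ h (c i * x)) x = c i ^ n • iteratedDeriv n h (c i * x) :=
      congrFun (iteratedDeriv_comp_const_smul
        ((hh.contDiff ()).of_le (by exact_mod_cast le_top)) (c i)) x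
    rw [this, norm_smul, norm_pow, Real.norm_eq_abs]
    have := (abs_nonneg _).trans (hc i)
    gcongr
    exacts [hc i, hM () _]

end UniformlySmoothBounded

/-- Averages `∫₀¹ θᵏ g(1 + θ (x - 1)) dθ` may be differentiated under the integral sign. -/
theorem hasDerivAt_integral_pow_mul_comp_affine {g : ℝ → ℂ} {M : ℝ}
    (hg : ContDiff ℝ 1 g) (hM : ∀ x, ‖deriv g x‖ ≤ M) (k : ℕ) (x : ℝ) :
    HasDerivAt (fun x : ℝ ↦ ∫ θ in (0 : ℝ)..1, (θ : ℂ) ^ k * g (1 + θ * (x - 1)))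
      (∫ θ in (0 : ℝ)..1, (θ : ℂ) ^ (k + 1) * deriv g (1 + θ * (x - 1))) x := by
  have hgc := hg.continuous
  have hdc := hg.continuous_deriv le_rfl
  refine (intervalIntegral.hasDerivAt_integral_of_dominated_loc_of_deriv_le
    (F := fun x θ ↦ (θ : ℂ) ^ k * g (1 + θ * (x - 1)))
    (F' := fun x θ ↦ (θ : ℂ) ^ (k + 1) * deriv g (1 + θ * (x - 1)))
    (s := Set.univ) (bound := fun _ ↦ M) Filter.univ_mem ?_ ?_ ?_ ?_ ?_ ?_).2
  · exact .of_forall fun y ↦ Continuous.aestronglyMeasurable (by fun_prop)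
  · exact Continuous.intervalIntegrable (by fun_prop) _ _
  · exact Continuous.aestronglyMeasurable (by fun_prop)
  · refine .of_forall fun θ hθ y _ ↦ ?_
    rw [Set.uIoc_of_le zero_le_one] at hθ
    rw [norm_mul, norm_pow, Complex.norm_real, Real.norm_of_nonneg hθ.1.le]
    exact (mul_le_of_le_one_left (norm_nonneg _) (pow_le_one₀ hθ.1.le hθ.2)).trans (hM _)
  · exact intervalIntegrable_const
  · refine .of_forall fun θ _ y _ ↦ ?_
    have h1 : HasDerivAt (fun y : ℝ ↦ 1 + θ * (y - 1)) θ y := by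
      simpa using (((hasDerivAt_id y).sub_const 1).const_mul θ).const_add 1
    have h2 := (hg.differentiable one_ne_zero (1 + θ * (y - 1))).hasDerivAt.scomp y h1
    rw [Complex.real_smul] at h2
    have h3 := h2.const_mul ((θ : ℂ) ^ k)
    rwa [← mul_assoc, ← pow_succ] at h3

/-- The smooth extension of the difference quotient `(g x - g 1) / (x - 1)`. -/
noncomputable def slopeAtOne (g : ℝ → ℂ) (x : ℝ) : ℂ :=
  ∫ θ in (0 : ℝ)..1, deriv g (1 + θ * (x - 1))

theorem sub_one_mul_slopeAtOne {g : ℝ → ℂ} (hg : ContDiff ℝ 1 g) (x : ℝ) :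
    ((x - 1 : ℝ) : ℂ) * slopeAtOne g x = g x - g 1 := by
  have hdc := hg.continuous_deriv le_rfl
  have h : ∀ θ ∈ Set.uIcc (0 : ℝ) 1, HasDerivAt (fun θ : ℝ ↦ g (1 + θ * (x - 1)))
      (((x - 1 : ℝ) : ℂ) * deriv g (1 + θ * (x - 1))) θ := by
    intro θ _
    have h1 : HasDerivAt (fun θ : ℝ ↦ 1 + θ * (x - 1)) (x - 1) θ := by
      simpa using ((hasDerivAt_id θ).mul_const (x - 1)).const_add 1
    have h2 := (hg.differentiable one_ne_zero (1 + θ * (x - 1))).hasDerivAt.scomp θ h1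
    rwa [Complex.real_smul] at h2
  have := intervalIntegral.integral_eq_sub_of_hasDerivAt h
    (Continuous.intervalIntegrable (by fun_prop) _ _)
  rw [slopeAtOne, ← intervalIntegral.integral_const_mul, this]
  simp

theorem UniformlySmoothBounded.slopeAtOne {ι : Type*} {f : ι → ℝ → ℂ}
    (hf : UniformlySmoothBounded f) : UniformlySmoothBounded fun i ↦ slopeAtOne (f i) := by
  have hsm : ∀ i n, ContDiff ℝ 1 (iteratedDeriv n (f i)) := fun i n ↦ by
    rw [iteratedDeriv_eq_iterate]
    exact ContDiff.iterate_deriv' 1 n ((hf.contDiff i).of_le (by exact_mod_cast le_top))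
  have key : ∀ i n, iteratedDeriv n (_root_.slopeAtOne (f i)) = fun x ↦
      ∫ θ in (0 : ℝ)..1, (θ : ℂ) ^ n * iteratedDeriv (n + 1) (f i) (1 + θ * (x - 1)) := by
    intro i n
    induction n with
    | zero => ext x; simp [_root_.slopeAtOne]
    | succ n ih =>
      rw [iteratedDeriv_succ, ih]
      ext x
      obtain ⟨M, hM⟩ := hf.exists_bound (n + 2)
      rw [iteratedDeriv_succ (n := n + 1)]
      exact (hasDerivAt_integral_pow_mul_comp_affine (M := M) (hsm i (n + 1))
        (fun x ↦ by rw [← iteratedDeriv_succ]; exact hM i x) n x).deriv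
  refine ⟨fun i ↦ contDiff_of_differentiable_iteratedDeriv fun n _ ↦ ?_, fun n ↦ ?_⟩
  · rw [key]
    obtain ⟨M, hM⟩ := hf.exists_bound (n + 2)
    exact fun x ↦ (hasDerivAt_integral_pow_mul_comp_affine (M := M) (hsm i (n + 1))
        (fun x ↦ by rw [← iteratedDeriv_succ]; exact hM i x) n x).differentiableAt
  · obtain ⟨M, hM⟩ := hf.exists_bound (n + 1)
    refine ⟨M, fun i x ↦ ?_⟩
    rw [key]
    have := intervalIntegral.norm_integral_le_of_norm_le_const (a := 0) (b := 1) (C := M)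
      (f := fun θ : ℝ ↦ (θ : ℂ) ^ n * iteratedDeriv (n + 1) (f i) (1 + θ * (x - 1))) ?_
    · simpa using this
    intro θ hθ
    rw [Set.uIoc_of_le zero_le_one] at hθ
    rw [norm_mul, norm_pow, Complex.norm_real, Real.norm_of_nonneg hθ.1.le]
    exact (mul_le_of_le_one_left (norm_nonneg _) (pow_le_one₀ hθ.1.le hθ.2)).trans (hM _ _)

theorem norm_e (x : ℝ) : ‖e x‖ = 1 := by
  rw [e, show (2 * Real.pi * Complex.I * x : ℂ) = ((2 * Real.pi * x : ℝ) : ℂ) * Complex.I by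
    push_cast; ring, Complex.norm_exp_ofReal_mul_I]

theorem e_add (x y : ℝ) : e (x + y) = e x * e y := by
  rw [e, e, e, ← Complex.exp_add]
  congr 1
  push_cast
  ring

theorem continuous_e : Continuous e := by
  unfold e
  fun_prop

theorem HasDerivAt.e_comp {φ : ℝ → ℝ} {φ' x : ℝ} (hφ : HasDerivAt φ φ' x) :
    HasDerivAt (fun x ↦ e (φ x)) (2 * Real.pi * Complex.I * φ' * e (φ x)) x := by
  have := (hφ.ofReal_comp.const_mul (2 * Real.pi * Complex.I)).cexp
  simpa only [e, mul_comm] using this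

/-- The oscillatory integral with the normalised cubic phase, whose critical point is `1`. -/
noncomputable def cubicIntegral (Λ : ℝ) (f : ℝ → ℂ) : ℂ :=
  ∫ x : ℝ, f x * e (Λ * (x ^ 3 - 3 / 2 * x ^ 2))

/-- The amplitude that remains after removing the value of `f` at the critical point by means of
`ρ` and integrating by parts; `m` stands for `1 / (3 x)`. -/
noncomputable def nextAmplitude (m ρ f : ℝ → ℂ) : ℝ → ℂ :=
  deriv fun x ↦ m x * slopeAtOne (fun y ↦ f y - f 1 * ρ y) x

theorem UniformlySmoothBounded.nextAmplitude {ι : Type*} {f : ι → ℝ → ℂ} {m ρ : ℝ → ℂ}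
    (hf : UniformlySmoothBounded f) (hm : UniformlySmoothBounded fun _ : ι ↦ m)
    (hρ : UniformlySmoothBounded fun _ : ι ↦ ρ) :
    UniformlySmoothBounded fun i ↦ nextAmplitude m ρ (f i) := by
  obtain ⟨M, hM⟩ := hf.bound_apply
  exact (hm.mul (hf.sub ((of_const fun i ↦ hM i 1).mul hρ)).slopeAtOne).deriv

section

variable {p q : ℝ} {m ρ f : ℝ → ℂ}

theorem mul_slopeAtOne_eq_zero (h1 : 1 ∈ Set.Icc p q) (hf : ContDiff ℝ (⊤ : ℕ∞) f)
    (hρ : ContDiff ℝ (⊤ : ℕ∞) ρ) (hρ1 : ρ 1 = 1) (hf0 : ∀ x ∉ Set.Icc p q, f x = 0)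
    (hρ0 : ∀ x ∉ Set.Icc p q, ρ x = 0) {x : ℝ} (hx : x ∉ Set.Icc p q) :
    m x * slopeAtOne (fun y ↦ f y - f 1 * ρ y) x = 0 := by
  have hg : ContDiff ℝ 1 (fun y ↦ f y - f 1 * ρ y) :=
    (hf.sub (contDiff_const.mul hρ)).of_le (by exact_mod_cast le_top)
  have h2 := sub_one_mul_slopeAtOne hg x
  have hx1 : ((x - 1 : ℝ) : ℂ) ≠ 0 := by
    rw [Complex.ofReal_ne_zero, sub_ne_zero]
    rintro rfl
    exact hx h1
  rw [hf0 x hx, hρ0 x hx, hρ1] at h2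
  have h3 : slopeAtOne (fun y ↦ f y - f 1 * ρ y) x = 0 := by
    simpa only [mul_zero, sub_zero, zero_sub, sub_self, zero_mul, mul_one, mul_eq_zero, hx1,
      false_or] using h2
  rw [h3, mul_zero]

theorem nextAmplitude_eq_zero (h1 : 1 ∈ Set.Icc p q) (hf : ContDiff ℝ (⊤ : ℕ∞) f)
    (hρ : ContDiff ℝ (⊤ : ℕ∞) ρ) (hρ1 : ρ 1 = 1) (hf0 : ∀ x ∉ Set.Icc p q, f x = 0)
    (hρ0 : ∀ x ∉ Set.Icc p q, ρ x = 0) {x : ℝ} (hx : x ∉ Set.Icc p q) :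
    nextAmplitude m ρ f x = 0 := by
  have : (fun x ↦ m x * slopeAtOne (fun y ↦ f y - f 1 * ρ y) x) =ᶠ[nhds x] fun _ ↦ 0 := by
    filter_upwards [isClosed_Icc.isOpen_compl.mem_nhds hx] with y hy
    exact mul_slopeAtOne_eq_zero h1 hf hρ hρ1 hf0 hρ0 hy
  rw [nextAmplitude, this.deriv_eq, deriv_const]

theorem integrable_mul_e {φ : ℝ → ℝ} (hφ : Continuous φ) (hf : Continuous f)
    (hf0 : ∀ x ∉ Set.Icc p q, f x = 0) : Integrable fun x ↦ f x * e (φ x) :=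
  (hf.mul (continuous_e.comp hφ)).integrable_of_hasCompactSupport
    (HasCompactSupport.intro (isCompact_Icc (a := p) (b := q)) fun x hx ↦ by simp [hf0 x hx])

theorem norm_cubicIntegral_le {C : ℝ} (hpq : p ≤ q)
    (hf0 : ∀ x ∉ Set.Icc p q, f x = 0) (hC : ∀ x, ‖f x‖ ≤ C) (Λ : ℝ) :
    ‖cubicIntegral Λ f‖ ≤ C * (q - p) := by
  have : cubicIntegral Λ f = ∫ x in Set.Icc p q, f x * e (Λ * (x ^ 3 - 3 / 2 * x ^ 2)) :=
    (setIntegral_eq_integral_of_forall_compl_eq_zero fun x hx ↦ by simp [hf0 x hx]).symm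
  rw [this]
  have h := norm_setIntegral_le_of_norm_le_const (μ := volume) (s := Set.Icc p q) (C := C)
    (f := fun x ↦ f x * e (Λ * (x ^ 3 - 3 / 2 * x ^ 2))) (by simp)
    (fun x _ ↦ by simpa [norm_e] using hC x)
  simpa [Measure.real, hpq] using h

/-- Removal of the critical point followed by integration by parts. -/
theorem cubicIntegral_eq (h1 : 1 ∈ Set.Icc p q) (hf : ContDiff ℝ (⊤ : ℕ∞) f)
    (hm : ContDiff ℝ (⊤ : ℕ∞) m) (hρ : ContDiff ℝ (⊤ : ℕ∞) ρ) (hρ1 : ρ 1 = 1)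
    (hf0 : ∀ x ∉ Set.Icc p q, f x = 0) (hρ0 : ∀ x ∉ Set.Icc p q, ρ x = 0)
    (hm1 : ∀ x ∈ Set.Icc p q, 3 * x * m x = 1) {Λ : ℝ} (hΛ : 0 < Λ) :
    cubicIntegral Λ f = f 1 * cubicIntegral Λ ρ -
      1 / (2 * Real.pi * Complex.I * Λ) * cubicIntegral Λ (nextAmplitude m ρ f) := by
  set φ : ℝ → ℝ := fun x ↦ Λ * (x ^ 3 - 3 / 2 * x ^ 2) with hφdef
  have hφ : Continuous φ := by fun_prop
  set g : ℝ → ℂ := fun y ↦ f y - f 1 * ρ y with hgdef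
  have hg : ContDiff ℝ (⊤ : ℕ∞) g := hf.sub (contDiff_const.mul hρ)
  set k : ℝ → ℂ := fun x ↦ m x * slopeAtOne g x
  have hsl : ContDiff ℝ (⊤ : ℕ∞) (slopeAtOne g) := by
    have h2 : ∀ {u : ℝ → ℂ}, ContDiff ℝ (⊤ : ℕ∞) u → (∀ x ∉ Set.Icc p q, u x = 0) →
        UniformlySmoothBounded fun _ : Unit ↦ u := fun hu hu0 ↦
      .of_hasCompactSupport hu (HasCompactSupport.intro isCompact_Icc hu0)
    exact (h2 hg fun x hx ↦ by simp [hgdef, hf0 x hx, hρ0 x hx]).slopeAtOne.contDiff ()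
  have hk : ContDiff ℝ (⊤ : ℕ∞) k := hm.mul hsl
  have hk0 : ∀ x ∉ Set.Icc p q, k x = 0 := fun x hx ↦
    mul_slopeAtOne_eq_zero h1 hf hρ hρ1 hf0 hρ0 hx
  have hT : Continuous (nextAmplitude m ρ f) := hk.continuous_deriv (by exact_mod_cast le_top)
  have hT0 : ∀ x ∉ Set.Icc p q, nextAmplitude m ρ f x = 0 := fun x hx ↦
    nextAmplitude_eq_zero h1 hf hρ hρ1 hf0 hρ0 hx
  have hkg : ∀ x, k x * (3 * x * (x - 1)) = g x := by
    intro x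
    by_cases hx : x ∈ Set.Icc p q
    · have h3 := sub_one_mul_slopeAtOne (hg.of_le (by exact_mod_cast le_top)) x
      have h4 : g 1 = 0 := by simp [hgdef, hρ1]
      rw [h4, sub_zero] at h3
      push_cast at h3
      linear_combination (3 * x * m x) * h3 + g x * hm1 x hx
    · rw [hk0 x hx]
      simp [hgdef, hf0 x hx, hρ0 x hx]
  have hφ' : ∀ x, HasDerivAt φ (Λ * (3 * x * (x - 1))) x := by
    intro x
    have := (((hasDerivAt_pow 3 x).sub ((hasDerivAt_pow 2 x).const_mul (3 / 2))).const_mul Λ)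
    refine this.congr_deriv ?_
    push_cast
    ring
  have hderiv : ∀ x, HasDerivAt (fun x ↦ k x * e (φ x))
      (nextAmplitude m ρ f x * e (φ x) +
        2 * Real.pi * Complex.I * Λ * (g x * e (φ x))) x := by
    intro x
    have h5 := ((hk.differentiable (by simp) x).hasDerivAt).mul (hφ' x).e_comp
    refine h5.congr_deriv ?_
    rw [← hkg x, show nextAmplitude m ρ f = deriv k from rfl]
    push_cast
    ring
  have hIT := integrable_mul_e hφ hT hT0
  have hIf := integrable_mul_e hφ hf.continuous hf0
  have hIρ := integrable_mul_e hφ hρ.continuous hρ0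
  have hge : ∀ x, g x * e (φ x) = f x * e (φ x) - f 1 * (ρ x * e (φ x)) := fun x ↦ by
    simp only [hgdef]; ring
  simp only [hge] at hderiv
  have hIg : Integrable fun x ↦
      2 * Real.pi * Complex.I * Λ * (f x * e (φ x) - f 1 * (ρ x * e (φ x))) :=
    (hIf.sub (hIρ.const_mul (f 1))).const_mul _
  have h6 := integral_eq_zero_of_hasDerivAt_of_integrable hderiv (hIT.add hIg)
    (integrable_mul_e hφ hk.continuous hk0)
  rw [integral_add hIT hIg, integral_const_mul] at h6
  have h7 : ∫ x, (f x * e (φ x) - f 1 * (ρ x * e (φ x))) =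
      cubicIntegral Λ f - f 1 * cubicIntegral Λ ρ := by
    rw [integral_sub hIf (hIρ.const_mul _), integral_const_mul]; rfl
  have h8 : ∫ x, nextAmplitude m ρ f x * e (φ x) = cubicIntegral Λ (nextAmplitude m ρ f) := rfl
  rw [h7, h8] at h6
  have hne : (2 * Real.pi * Complex.I * Λ : ℂ) ≠ 0 := by
    simp [Real.pi_ne_zero, hΛ.ne']
  have h9 : cubicIntegral Λ (nextAmplitude m ρ f) =
      -(2 * Real.pi * Complex.I * Λ * (cubicIntegral Λ f - f 1 * cubicIntegral Λ ρ)) := by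
    linear_combination h6
  rw [h9, mul_neg, ← mul_assoc, one_div_mul_cancel hne]
  ring

end

/-- Uniform stationary phase for a family of amplitudes, relative to a reference amplitude `ρ`. -/
theorem UniformlySmoothBounded.exists_norm_cubicIntegral_sub_le {ι : Type*} {f : ι → ℝ → ℂ}
    {p q C₀ : ℝ} {m ρ : ℝ → ℂ} (hf : UniformlySmoothBounded f) (h1 : 1 ∈ Set.Icc p q)
    (hm : UniformlySmoothBounded fun _ : ι ↦ m) (hρ : UniformlySmoothBounded fun _ : ι ↦ ρ)
    (hρ1 : ρ 1 = 1) (hf0 : ∀ i, ∀ x ∉ Set.Icc p q, f i x = 0)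
    (hρ0 : ∀ x ∉ Set.Icc p q, ρ x = 0) (hm1 : ∀ x ∈ Set.Icc p q, 3 * x * m x = 1)
    (hρΛ : ∀ Λ : ℝ, 1 ≤ Λ → ‖cubicIntegral Λ ρ‖ ≤ C₀ * Λ ^ (-(1 : ℝ) / 2)) :
    ∃ C, ∀ i, ∀ Λ : ℝ, 1 ≤ Λ →
      ‖cubicIntegral Λ (f i) - f i 1 * cubicIntegral Λ ρ‖ ≤ C * Λ ^ (-(3 : ℝ) / 2) := by
  have hT := hf.nextAmplitude hm hρ
  have hTT := hT.nextAmplitude hm hρ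
  obtain ⟨M, hM⟩ := hT.bound_apply
  obtain ⟨N, hN⟩ := hTT.bound_apply
  refine ⟨|M| * C₀ + |N| * (q - p), fun i Λ hΛ ↦ ?_⟩
  have hΛ0 : 0 < Λ := one_pos.trans_le hΛ
  have hpq : p ≤ q := h1.1.trans h1.2
  have hρs := hρ.contDiff i
  have hT0 : ∀ x ∉ Set.Icc p q, _root_.nextAmplitude m ρ (f i) x = 0 := fun x hx ↦
    nextAmplitude_eq_zero h1 (hf.contDiff i) hρs hρ1 (hf0 i) hρ0 hx
  have hTT0 : ∀ x ∉ Set.Icc p q,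
      _root_.nextAmplitude m ρ (_root_.nextAmplitude m ρ (f i)) x = 0 := fun x hx ↦
    nextAmplitude_eq_zero h1 (hT.contDiff i) hρs hρ1 hT0 hρ0 hx
  rw [cubicIntegral_eq h1 (hf.contDiff i) (hm.contDiff i) hρs hρ1 (hf0 i) hρ0 hm1 hΛ0,
    cubicIntegral_eq h1 (hT.contDiff i) (hm.contDiff i) hρs hρ1 hT0 hρ0 hm1 hΛ0, sub_sub_cancel_left,
    norm_neg]
  set Tf := _root_.nextAmplitude m ρ (f i)
  have hc : ‖(1 / (2 * Real.pi * Complex.I * Λ) : ℂ)‖ ≤ Λ ^ (-1 : ℝ) := by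
    rw [norm_div, Real.rpow_neg_one]
    simp only [norm_mul, norm_one, Complex.norm_I, Complex.norm_real, Complex.norm_ofNat,
      Real.norm_of_nonneg Real.pi_pos.le, Real.norm_of_nonneg hΛ0.le, mul_one]
    rw [one_div]
    apply inv_anti₀ hΛ0
    nlinarith [Real.pi_gt_three]
  have hI := norm_cubicIntegral_le hpq hTT0 (fun x ↦ (hN i x).trans (le_abs_self N)) Λ
  have e1 : Λ ^ (-(3 : ℝ) / 2) = Λ ^ (-1 : ℝ) * Λ ^ (-(1 : ℝ) / 2) := by
    rw [← Real.rpow_add hΛ0]; norm_num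
  have e2 : Λ ^ (-1 : ℝ) ≤ Λ ^ (-(1 : ℝ) / 2) :=
    Real.rpow_le_rpow_of_exponent_le hΛ (by norm_num)
  have e3 : 0 ≤ Λ ^ (-1 : ℝ) := by positivity
  have hMi : ‖Tf 1‖ ≤ |M| := (hM i 1).trans (le_abs_self M)
  have hqp : 0 ≤ q - p := sub_nonneg.mpr hpq
  rw [norm_mul]
  calc _ ≤ Λ ^ (-1 : ℝ) * (|M| * (C₀ * Λ ^ (-(1 : ℝ) / 2)) +
        Λ ^ (-1 : ℝ) * (|N| * (q - p))) := by
        refine mul_le_mul hc ((norm_sub_le _ _).trans ?_) (norm_nonneg _) e3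
        rw [norm_mul, norm_mul]
        gcongr
        exact hρΛ Λ hΛ
    _ ≤ Λ ^ (-1 : ℝ) * (|M| * (C₀ * Λ ^ (-(1 : ℝ) / 2)) +
        Λ ^ (-(1 : ℝ) / 2) * (|N| * (q - p))) := by gcongr
    _ = _ := by rw [e1]; ring

theorem contDiff_of_forall_lt_eq_zero {E : Type*} [NormedAddCommGroup E] [NormedSpace ℝ E]
    {n : WithTop ℕ∞} {g : ℝ → E} {a : ℝ} (ha : 0 < a) (h0 : ∀ x < a, g x = 0)
    (h : ∀ x, 0 < x → ContDiffAt ℝ n g x) : ContDiff ℝ n g := by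
  rw [contDiff_iff_contDiffAt]
  intro x
  rcases lt_or_ge 0 x with hx | hx
  · exact h x hx
  · refine (contDiffAt_const (c := (0 : E))).congr_of_eventuallyEq ?_
    filter_upwards [isOpen_Iio.mem_nhds (show x ∈ Set.Iio a from hx.trans_lt ha)] with y hy
    exact h0 y hy

theorem exists_smooth_eq_inv_three_mul {p q : ℝ} (hp : 0 < p) (hpq : p < q) :
    ∃ m : ℝ → ℂ, ContDiff ℝ (⊤ : ℕ∞) m ∧ HasCompactSupport m ∧
      ∀ x ∈ Set.Icc p q, 3 * x * m x = 1 := by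
  let η : ContDiffBump ((p + q) / 2) :=
    ⟨(q - p) / 2, (q - p) / 2 + p / 2, by linarith, by linarith⟩
  have hη0 : ∀ x < p / 2, η x = 0 := fun x hx ↦ η.zero_of_le_dist (by
    rw [Real.dist_eq, abs_of_nonpos (by linarith)]
    change (q - p) / 2 + p / 2 ≤ _
    linarith)
  refine ⟨fun x ↦ ((η x * (3 * x)⁻¹ : ℝ) : ℂ), ?_, ?_, ?_⟩
  · refine contDiff_of_forall_lt_eq_zero (a := p / 2) (by linarith)
      (fun x hx ↦ by simp [hη0 x hx]) fun x hx ↦ ?_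
    refine Complex.ofRealCLM.contDiff.contDiffAt.comp x ?_
    refine η.contDiff.contDiffAt.mul (ContDiffAt.inv (by fun_prop) (by positivity))
  · refine η.hasCompactSupport.mono' fun x hx ↦ subset_tsupport _ ?_
    intro h0
    exact hx (by simp [h0])
  · intro x hx
    have h1 : η x = 1 := η.one_of_mem_closedBall (by
      rw [Metric.mem_closedBall, Real.dist_eq, abs_le]
      change -((q - p) / 2) ≤ _ ∧ _ ≤ (q - p) / 2
      constructor <;> linarith [hx.1, hx.2])
    have h2 : (x : ℂ) ≠ 0 := by exact_mod_cast (hp.trans_le hx.1).ne'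
    beta_reduce
    rw [h1]
    push_cast
    field_simp

theorem hasDerivAt_sub_one_mul_sqrt {x : ℝ} (hx : 0 < x) :
    HasDerivAt (fun x ↦ (x - 1) * Real.sqrt (x + 1 / 2))
      (Real.sqrt (x + 1 / 2) + (x - 1) * (1 / (2 * Real.sqrt (x + 1 / 2)))) x := by
  have h1 : HasDerivAt (fun x : ℝ ↦ Real.sqrt (x + 1 / 2)) (1 / (2 * Real.sqrt (x + 1 / 2))) x := by
    exact ((hasDerivAt_id x).add_const (1 / 2)).sqrt (by simp; linarith)
  exact (((hasDerivAt_id x).sub_const 1).mul h1).congr_deriv (by simp)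

/-- A reference amplitude for the cubic phase, equal to `1` at the critical point, with the
expected asymptotics. -/
theorem exists_reference_amplitude :
    ∃ ρ : ℝ → ℂ, ContDiff ℝ (⊤ : ℕ∞) ρ ∧ (∀ x ∉ Set.Icc (1 / 2 : ℝ) (3 / 2), ρ x = 0) ∧ ρ 1 = 1 ∧
      ∃ C, ∀ Λ : ℝ, 0 < Λ →
        ‖cubicIntegral Λ ρ - ((1 / Real.sqrt (3 * Λ) : ℝ) : ℂ) * e (-Λ / 2 + 1 / 8)‖ ≤
          C * Λ ^ (-(3 : ℝ) / 2) := by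
  let η : ContDiffBump (1 : ℝ) := ⟨1 / 4, 1 / 2, by norm_num, by norm_num⟩
  let b : ContDiffBump (0 : ℝ) := ⟨1 / 8, 1 / 4, by norm_num, by norm_num⟩
  have hη0 : ∀ x, 1 / 2 ≤ |x - 1| → η x = 0 := fun x hx ↦ η.zero_of_le_dist hx
  have hη1 : ∀ x, |x - 1| ≤ 1 / 4 → η x = 1 := fun x hx ↦ η.one_of_mem_closedBall hx
  have hb0 : ∀ y, 1 / 4 ≤ |y| → b y = 0 := fun y hy ↦
    b.zero_of_le_dist (by rw [Real.dist_eq, sub_zero]; exact hy)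
  set u : ℝ → ℝ := fun x ↦ (x - 1) * Real.sqrt (x + 1 / 2) with hu
  set v : ℝ → ℝ := fun x ↦
    Real.sqrt (x + 1 / 2) + (x - 1) * (1 / (2 * Real.sqrt (x + 1 / 2))) with hv
  have hu_abs : ∀ x, 1 / 2 ≤ x → |x - 1| ≤ |u x| := fun x hx ↦ by
    rw [hu, abs_mul, abs_of_nonneg (Real.sqrt_nonneg _)]
    exact le_mul_of_one_le_right (abs_nonneg _) (Real.one_le_sqrt.mpr (by linarith))
  have husq : ∀ x, 0 < x → u x ^ 2 = x ^ 3 - 3 / 2 * x ^ 2 + 1 / 2 := fun x hx ↦ by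
    rw [hu, mul_pow, Real.sq_sqrt (by linarith)]
    ring
  have hud : ∀ x, 0 < x → HasDerivAt u (v x) x := fun x hx ↦ hasDerivAt_sub_one_mul_sqrt hx
  set s := Real.sqrt (2 / 3) with hs
  refine ⟨fun x ↦ ((η x * b (u x) * v x * s : ℝ) : ℂ), ?_, ?_, ?_, ?_⟩
  · refine contDiff_of_forall_lt_eq_zero (a := 1 / 2) (by norm_num) (fun x hx ↦ ?_) fun x hx ↦ ?_
    · rw [hη0 x (by rw [abs_of_nonpos] <;> linarith)]
      simp
    · have hsq : ContDiffAt ℝ (⊤ : ℕ∞) (fun x : ℝ ↦ Real.sqrt (x + 1 / 2)) x :=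
        ContDiffAt.sqrt (by fun_prop) (by linarith)
      have hpos : 2 * Real.sqrt (x + 1 / 2) ≠ 0 := by positivity
      have hid : ContDiffAt ℝ (⊤ : ℕ∞) (fun x : ℝ ↦ x - 1) x := by fun_prop
      have hvc : ContDiffAt ℝ (⊤ : ℕ∞) v x :=
        hsq.add (hid.mul (contDiffAt_const.div (contDiffAt_const.mul hsq) hpos))
      have huc : ContDiffAt ℝ (⊤ : ℕ∞) u x := hid.mul hsq
      exact Complex.ofRealCLM.contDiff.contDiffAt.comp x
        (((η.contDiff.contDiffAt.mul (b.contDiff.contDiffAt.comp x huc)).mul hvc).mul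
          contDiffAt_const)
  · intro x hx
    beta_reduce
    rw [hη0 x]
    · simp
    · by_contra! h
      rw [abs_lt] at h
      exact hx ⟨by linarith, by linarith⟩
  · have h1 : u 1 = 0 := by simp [hu]
    have h2 : v 1 = Real.sqrt (3 / 2) := by simp only [hv]; norm_num
    have h3 : b 0 = 1 := b.one_of_mem_closedBall (by simp [b.rIn_pos.le])
    beta_reduce
    rw [hη1 1 (by norm_num), h1, h2, h3, hs, one_mul, one_mul, ← Real.sqrt_mul (by norm_num)]
    norm_num
  have hbs : ContDiff ℝ (⊤ : ℕ∞) fun y ↦ (b y : ℂ) :=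
    Complex.ofRealCLM.contDiff.comp b.contDiff
  have hbc : HasCompactSupport fun y ↦ (b y : ℂ) :=
    b.hasCompactSupport.comp_left (g := ((↑) : ℝ → ℂ)) Complex.ofReal_zero
  obtain ⟨C, hC⟩ := exists_norm_integral_mul_e_sq_sub_le (hbc.toSchwartzMap hbs)
  refine ⟨s * C, fun Λ hΛ ↦ ?_⟩
  have hC' := hC Λ hΛ
  have hbS : ∀ y, hbc.toSchwartzMap hbs y = (b y : ℂ) := fun y ↦ rfl
  simp only [hbS] at hC'
  have h3 : b 0 = 1 := b.one_of_mem_closedBall (by simp [b.rIn_pos.le])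
  rw [h3, Complex.ofReal_one, mul_one] at hC'
  have hI : cubicIntegral Λ (fun x ↦ ((η x * b (u x) * v x * s : ℝ) : ℂ)) =
      s * e (-Λ / 2) * ∫ y : ℝ, (b y : ℂ) * e (Λ * y ^ 2) := by
    have hout : ∀ x ∉ Set.Ioc (3 / 4 : ℝ) (5 / 4), η x * b (u x) = 0 := by
      intro x hx
      have hx' : 1 / 4 ≤ |x - 1| := by
        by_contra! h
        rw [abs_lt] at h
        exact hx ⟨by linarith, by linarith⟩
      rcases lt_or_ge x (1 / 2) with h | h
      · rw [hη0 x (by rw [abs_of_nonpos] <;> linarith), zero_mul]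
      · rw [hb0 _ (hx'.trans (hu_abs x h)), mul_zero]
    have hL : cubicIntegral Λ (fun x ↦ ((η x * b (u x) * v x * s : ℝ) : ℂ)) =
        ∫ x in (3 / 4 : ℝ)..(5 / 4),
          s * e (-Λ / 2) * (v x • ((fun y : ℝ ↦ (b y : ℂ) * e (Λ * y ^ 2)) ∘ u) x) := by
      rw [intervalIntegral.integral_of_le (by norm_num), cubicIntegral,
        ← setIntegral_eq_integral_of_forall_compl_eq_zero (s := Set.Ioc (3 / 4 : ℝ) (5 / 4))]
      · refine setIntegral_congr_fun measurableSet_Ioc fun x hx ↦ ?_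
        have hph : Λ * (x ^ 3 - 3 / 2 * x ^ 2) = -Λ / 2 + Λ * u x ^ 2 := by
          rw [husq x (by linarith [hx.1])]; ring
        simp only [Function.comp_apply, Complex.real_smul]
        rw [hph, e_add, hη1 x (by rw [abs_le]; constructor <;> linarith [hx.1, hx.2])]
        push_cast
        ring
      · intro x hx
        rw [hout x hx]
        simp
    have hpos : ∀ x ∈ Set.uIcc (3 / 4 : ℝ) (5 / 4), 0 < x := fun x hx ↦ by
      rw [Set.uIcc_of_le (by norm_num)] at hx
      linarith [hx.1]
    have hsqc : Continuous fun x : ℝ ↦ Real.sqrt (x + 1 / 2) := by fun_prop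
    have hvc : ContinuousOn v (Set.uIcc (3 / 4 : ℝ) (5 / 4)) := by
      refine hsqc.continuousOn.add (ContinuousOn.mul (by fun_prop)
        (ContinuousOn.div (by fun_prop) (by fun_prop) fun x hx ↦ ?_))
      have := hpos x hx
      positivity
    have hgc : Continuous fun y : ℝ ↦ (b y : ℂ) * e (Λ * y ^ 2) :=
      hbs.continuous.mul (continuous_e.comp (by fun_prop))
    rw [hL, intervalIntegral.integral_const_mul, intervalIntegral.integral_deriv_smul_comp
      (fun x hx ↦ hud x (hpos x hx)) hvc hgc]
    congr 1
    have hlo : u (3 / 4) ≤ -(1 / 4) := by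
      have h := hu_abs (3 / 4) (by norm_num)
      have h' : u (3 / 4) ≤ 0 :=
        mul_nonpos_of_nonpos_of_nonneg (by norm_num) (Real.sqrt_nonneg _)
      rw [abs_of_nonpos h', abs_of_nonpos (by norm_num)] at h
      linarith
    have hhi : 1 / 4 ≤ u (5 / 4) := by
      have h := hu_abs (5 / 4) (by norm_num)
      have h' : 0 ≤ u (5 / 4) := mul_nonneg (by norm_num) (Real.sqrt_nonneg _)
      rw [abs_of_nonneg h', abs_of_nonneg (by norm_num)] at h
      linarith
    rw [intervalIntegral.integral_of_le (by linarith)]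
    refine setIntegral_eq_integral_of_forall_compl_eq_zero fun y hy ↦ ?_
    rw [hb0 y, Complex.ofReal_zero, zero_mul]
    by_contra! h
    rw [abs_lt] at h
    exact hy ⟨by linarith, by linarith⟩
  have hmain : ((1 / Real.sqrt (3 * Λ) : ℝ) : ℂ) * e (-Λ / 2 + 1 / 8) =
      s * e (-Λ / 2) * (((1 / Real.sqrt (2 * Λ) : ℝ) : ℂ) * e (1 / 8)) := by
    have h4 : 1 / Real.sqrt (3 * Λ) = s * (1 / Real.sqrt (2 * Λ)) := by
      rw [hs, mul_one_div, ← Real.sqrt_div' _ (by positivity), one_div, ← Real.sqrt_inv]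
      congr 1
      field_simp
    rw [h4, e_add]
    push_cast
    ring
  rw [hI, hmain, ← mul_sub, norm_mul, norm_mul, norm_e, mul_one, Complex.norm_real,
    Real.norm_of_nonneg (Real.sqrt_nonneg _), mul_assoc]
  exact mul_le_mul_of_nonneg_left hC' (Real.sqrt_nonneg _)

theorem IsCompact.exists_subset_Icc_of_subset_Ioi {S : Set ℝ} (hS : IsCompact S)
    (h0 : S ⊆ Set.Ioi 0) : ∃ a b : ℝ, 0 < a ∧ a ≤ b ∧ S ⊆ Set.Icc a b := by
  rcases S.eq_empty_or_nonempty with rfl | hne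
  · exact ⟨1, 1, one_pos, le_rfl, Set.empty_subset _⟩
  · obtain ⟨a, ha⟩ := hS.exists_isLeast hne
    obtain ⟨b, hb⟩ := hS.exists_isGreatest hne
    exact ⟨a, b, h0 ha.1, ha.2 hb.1, fun x hx ↦ ⟨ha.2 hx, hb.2 hx⟩⟩

theorem integral_cubic_phase_eq {h : ℝ → ℂ} (h0 : ∀ x ≤ 0, h x = 0) {α β c : ℝ} (hc : 0 < c)
    (hβ : 2 * β = 3 * (α * c)) :
    ∫ t in Set.Ioi (0 : ℝ), h t * e (α * t ^ 3 - β * t ^ 2) =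
      cubicIntegral (α * c ^ 3) fun x ↦ c * h (c * x) := by
  have h1 := integral_comp_mul_left_Ioi (fun t ↦ h t * e (α * t ^ 3 - β * t ^ 2)) 0 hc
  rw [mul_zero, eq_inv_smul_iff₀ hc.ne'] at h1
  rw [← h1, cubicIntegral, ← integral_smul,
    setIntegral_eq_integral_of_forall_compl_eq_zero]
  · refine integral_congr_ae (.of_forall fun x ↦ ?_)
    simp only [Complex.real_smul]
    have : α * (c * x) ^ 3 - β * (c * x) ^ 2 = α * c ^ 3 * (x ^ 3 - 3 / 2 * x ^ 2) := by
      linear_combination -(c ^ 2 * x ^ 2 / 2) * hβ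
    rw [this]
    ring
  · intro x hx
    rw [h0 (c * x) (mul_nonpos_of_nonneg_of_nonpos hc.le (not_lt.mp hx))]
    simp

theorem stmt8 (h : ℝ → ℂ) (hsm : ContDiff ℝ (⊤ : ℕ∞) h) (hcs : HasCompactSupport h)
    (hpos : tsupport h ⊆ Set.Ioi 0)
    (K : Set ℝ) (hK : IsCompact K) (hKpos : K ⊆ Set.Ioi 0) :
    ∃ C > (0:ℝ), ∃ α₀ > (0:ℝ), ∀ α β : ℝ, α₀ ≤ α → β / α ∈ K →
      ‖(∫ t in Set.Ioi (0:ℝ), h t * e (α * t ^ 3 - β * t ^ 2)) -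
          ((1 / Real.sqrt (2 * β) : ℝ) : ℂ) *
            e (-(4 * β ^ 3) / (27 * α ^ 2) + 1 / 8) * h (2 * β / (3 * α))‖
        ≤ C * α ^ (-(3:ℝ)/2) := by
  obtain ⟨a, b, ha, -, hSab⟩ := hcs.isCompact.exists_subset_Icc_of_subset_Ioi hpos
  obtain ⟨k₀, k₁, hk₀, hk₀₁, hKk⟩ := hK.exists_subset_Icc_of_subset_Ioi hKpos
  have hzero : ∀ x ∉ Set.Icc a b, h x = 0 := fun x hx ↦
    image_eq_zero_of_notMem_tsupport fun hx' ↦ hx (hSab hx')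
  obtain ⟨ρ, hρs, hρ0, hρ1, C₁, hC₁⟩ := exists_reference_amplitude
  set c₀ := 2 * k₀ / 3
  set c₁ := 2 * k₁ / 3
  have hc₀ : 0 < c₀ := by positivity
  have hc₀₁ : c₀ ≤ c₁ := by simp only [c₀, c₁]; linarith
  have hc₁ : 0 < c₁ := hc₀.trans_le hc₀₁
  set p := min (1 / 2) (a / c₁)
  set q := max (3 / 2) (b / c₀)
  have hp : 0 < p := lt_min (by norm_num) (by positivity)
  have hp2 : p ≤ 1 / 2 := min_le_left _ _
  have hq2 : 3 / 2 ≤ q := le_max_left _ _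
  have hρ0' : ∀ x ∉ Set.Icc p q, ρ x = 0 := fun x hx ↦
    hρ0 x fun hx' ↦ hx ⟨hp2.trans hx'.1, hx'.2.trans hq2⟩
  obtain ⟨m, hms, hmc, hm1⟩ := exists_smooth_eq_inv_three_mul hp (show p < q by linarith)
  let f : Set.Icc c₀ c₁ → ℝ → ℂ := fun c x ↦ (c : ℝ) * h (c * x)
  have hcabs : ∀ c : Set.Icc c₀ c₁, |(c : ℝ)| ≤ c₁ := fun c ↦ by
    rw [abs_of_pos (hc₀.trans_le c.2.1)]; exact c.2.2
  have hf : UniformlySmoothBounded f :=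
    (UniformlySmoothBounded.of_const (M := c₁) fun c ↦ by
      rw [Complex.norm_real]; exact hcabs c).mul
      ((UniformlySmoothBounded.of_hasCompactSupport hsm hcs).comp_mul hcabs)
  have hf0 : ∀ c, ∀ x ∉ Set.Icc p q, f c x = 0 := by
    intro c x hx
    have hcpos := hc₀.trans_le c.2.1
    rw [show f c x = (c : ℝ) * h (c * x) from rfl, hzero, mul_zero]
    rintro ⟨h1, h2⟩
    have hx0 : 0 < x := pos_of_mul_pos_right (ha.trans_le h1) hcpos.le
    refine hx ⟨(min_le_right _ _).trans ?_, le_trans ?_ (le_max_right _ _)⟩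
    · rw [div_le_iff₀ hc₁]
      nlinarith [c.2.2]
    · rw [le_div_iff₀ hc₀]
      nlinarith [c.2.1]
  have hρc : HasCompactSupport ρ := HasCompactSupport.intro isCompact_Icc hρ0'
  have hρΛ : ∀ Λ : ℝ, 1 ≤ Λ → ‖cubicIntegral Λ ρ‖ ≤ (1 + |C₁|) * Λ ^ (-(1 : ℝ) / 2) := by
    intro Λ hΛ
    have hΛ0 : 0 < Λ := one_pos.trans_le hΛ
    have h1 : ‖((1 / Real.sqrt (3 * Λ) : ℝ) : ℂ) * e (-Λ / 2 + 1 / 8)‖ ≤ Λ ^ (-(1 : ℝ) / 2) := by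
      rw [norm_mul, norm_e, mul_one, Complex.norm_real, Real.norm_of_nonneg (by positivity),
        neg_div, Real.rpow_neg hΛ0.le, ← Real.sqrt_eq_rpow, ← one_div]
      gcongr
      linarith
    have h2 : C₁ * Λ ^ (-(3 : ℝ) / 2) ≤ |C₁| * Λ ^ (-(1 : ℝ) / 2) :=
      mul_le_mul (le_abs_self _) (Real.rpow_le_rpow_of_exponent_le hΛ (by norm_num)) (by positivity)
        (abs_nonneg _)
    have h3 := norm_add_le (cubicIntegral Λ ρ -
      ((1 / Real.sqrt (3 * Λ) : ℝ) : ℂ) * e (-Λ / 2 + 1 / 8))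
      (((1 / Real.sqrt (3 * Λ) : ℝ) : ℂ) * e (-Λ / 2 + 1 / 8))
    rw [sub_add_cancel] at h3
    linarith [hC₁ Λ hΛ0]
  obtain ⟨C₂, hC₂⟩ := hf.exists_norm_cubicIntegral_sub_le (p := p) (q := q)
    ⟨by linarith, by linarith⟩ (.of_hasCompactSupport hms hmc) (.of_hasCompactSupport hρs hρc)
    hρ1 hf0 hρ0' hm1 hρΛ
  obtain ⟨M, hM⟩ := hf.bound_apply
  set D := |C₂| + |M| * |C₁|
  have hD : 0 ≤ D := by positivity
  refine ⟨(D + 1) * (c₀ ^ 3) ^ (-(3 : ℝ) / 2), by positivity, (c₀ ^ 3)⁻¹, by positivity,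
    fun α β hα hαβ ↦ ?_⟩
  have hα0 : 0 < α := lt_of_lt_of_le (by positivity) hα
  set c := 2 * β / (3 * α) with hcdef
  have hcmem : c ∈ Set.Icc c₀ c₁ := by
    have h1 := hKk hαβ
    have h2 : c = 2 * (β / α) / 3 := by rw [hcdef]; field_simp
    rw [h2]
    constructor
    · simp only [c₀]; linarith [h1.1]
    · simp only [c₁]; linarith [h1.2]
  have hc : 0 < c := hc₀.trans_le hcmem.1
  have hβ : 2 * β = 3 * (α * c) := by rw [hcdef]; field_simp
  have hΛα : α * c₀ ^ 3 ≤ α * c ^ 3 := by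
    gcongr
    exact hcmem.1
  set Λ := α * c ^ 3 with hΛdef
  have hΛ1 : 1 ≤ Λ := by
    refine le_trans ?_ hΛα
    rw [inv_le_iff_one_le_mul₀ (by positivity)] at hα
    exact hα
  have hΛ0 : 0 < Λ := one_pos.trans_le hΛ1
  have hmain : ((1 / Real.sqrt (2 * β) : ℝ) : ℂ) *
      e (-(4 * β ^ 3) / (27 * α ^ 2) + 1 / 8) * h c =
      f ⟨c, hcmem⟩ 1 * (((1 / Real.sqrt (3 * Λ) : ℝ) : ℂ) * e (-Λ / 2 + 1 / 8)) := by
    have h1 : -(4 * β ^ 3) / (27 * α ^ 2) = -Λ / 2 := by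
      rw [hΛdef, hcdef]; field_simp; ring
    have h2 : 1 / Real.sqrt (2 * β) = c * (1 / Real.sqrt (3 * Λ)) := by
      have : 3 * Λ = c ^ 2 * (2 * β) := by rw [hΛdef, hβ]; ring
      rw [this, Real.sqrt_mul (sq_nonneg c) (2 * β), Real.sqrt_sq hc.le]
      field_simp
    rw [h1, h2, show f ⟨c, hcmem⟩ 1 = c * h (c * 1) from rfl, mul_one]
    push_cast
    ring
  have h_rescale := integral_cubic_phase_eq (h := h) (α := α) (β := β) (c := c)
    (fun x hx ↦ hzero x fun hx' ↦ (ha.trans_le hx'.1).not_ge hx) hc hβ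
  rw [h_rescale, hmain]
  change ‖cubicIntegral Λ (f ⟨c, hcmem⟩) - _‖ ≤ _
  have hA := hC₂ ⟨c, hcmem⟩ Λ hΛ1
  have hB := hC₁ Λ hΛ0
  have hP : 0 ≤ Λ ^ (-(3 : ℝ) / 2) := by positivity
  have hbound : ‖cubicIntegral Λ (f ⟨c, hcmem⟩) -
      f ⟨c, hcmem⟩ 1 * (((1 / Real.sqrt (3 * Λ) : ℝ) : ℂ) * e (-Λ / 2 + 1 / 8))‖ ≤
      D * Λ ^ (-(3 : ℝ) / 2) := by
    calc _ = ‖(cubicIntegral Λ (f ⟨c, hcmem⟩) - f ⟨c, hcmem⟩ 1 * cubicIntegral Λ ρ) +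
          f ⟨c, hcmem⟩ 1 * (cubicIntegral Λ ρ -
            ((1 / Real.sqrt (3 * Λ) : ℝ) : ℂ) * e (-Λ / 2 + 1 / 8))‖ := by
          congr 1; ring
      _ ≤ C₂ * Λ ^ (-(3 : ℝ) / 2) + |M| * (|C₁| * Λ ^ (-(3 : ℝ) / 2)) := by
          refine (norm_add_le _ _).trans (add_le_add hA ?_)
          rw [norm_mul]
          refine mul_le_mul ((hM _ _).trans (le_abs_self M)) (hB.trans ?_) (norm_nonneg _)
            (abs_nonneg _)
          gcongr
          exact le_abs_self _
      _ ≤ _ := by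
          have := mul_le_mul_of_nonneg_right (le_abs_self C₂) hP
          simp only [D]
          linarith
  calc _ ≤ D * Λ ^ (-(3 : ℝ) / 2) := hbound
    _ ≤ (D + 1) * (α * c₀ ^ 3) ^ (-(3 : ℝ) / 2) := by
        refine mul_le_mul (by linarith) ?_ hP (by positivity)
        exact Real.rpow_le_rpow_of_nonpos (by positivity) hΛα (by norm_num)
    _ = _ := by rw [Real.mul_rpow hα0.le (by positivity)]; ring
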